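/- The map σ is a B-isometry of V of order exactly p; it maps N onto N and L onto L; and (σ − id)(L^∨) ⊆ L, i.e. σ acts trivially on the discriminant group L^∨/L. -/

import Mathlib

open scoped BigOperators

namespace Nikulin

noncomputable section

/-- Index set for the basis vectors `D_{i,j}`, `1 ≤ i ≤ ν`, `1 ≤ j ≤ p−1`. -/
abbrev Idx (p ν : ℕ) := Fin ν × Fin (p - 1)

variable (p ν : ℕ)

/-- The Gram matrix of the form `B` on the basis `D_{i,j}`:
`B(D_{i,j}, D_{i,j}) = −2`, `B(D_{i,j}, D_{i,j±1}) = 1`, all other entries `0`. -/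
def gram (a b : Idx p ν) : ℚ :=
  if a.1 = b.1 then
    if a.2 = b.2 then -2
    else if a.2.1 + 1 = b.2.1 ∨ b.2.1 + 1 = a.2.1 then 1 else 0
  else 0

/-- The symmetric bilinear form `B` on `V`, the bilinear extension of the Gram matrix. -/
def Bf : (Idx p ν → ℚ) →ₗ[ℚ] (Idx p ν → ℚ) →ₗ[ℚ] ℚ :=
  LinearMap.mk₂ ℚ (fun x y => ∑ a : Idx p ν, ∑ b : Idx p ν, x a * gram p ν a b * y b)
    (by
      intro x x' y
      rw [← Finset.sum_add_distrib]
      refine Finset.sum_congr rfl fun a _ => ?_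
      rw [← Finset.sum_add_distrib]
      refine Finset.sum_congr rfl fun b _ => ?_
      simp only [Pi.add_apply]; ring)
    (by
      intro c x y
      rw [Finset.smul_sum]
      refine Finset.sum_congr rfl fun a _ => ?_
      rw [Finset.smul_sum]
      refine Finset.sum_congr rfl fun b _ => ?_
      simp only [Pi.smul_apply, smul_eq_mul]; ring)
    (by
      intro x y y'
      rw [← Finset.sum_add_distrib]
      refine Finset.sum_congr rfl fun a _ => ?_
      rw [← Finset.sum_add_distrib]
      refine Finset.sum_congr rfl fun b _ => ?_
      simp only [Pi.add_apply]; ring)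
    (by
      intro c x y
      rw [Finset.smul_sum]
      refine Finset.sum_congr rfl fun a _ => ?_
      rw [Finset.smul_sum]
      refine Finset.sum_congr rfl fun b _ => ?_
      simp only [Pi.smul_apply, smul_eq_mul]; ring)

/-- The basis vector `D_{i,j}` (the index `q = (i, j)` with `j ∈ Fin (p−1)` representing
`j+1 ∈ {1, …, p−1}`). -/
def Dv (q : Idx p ν) : Idx p ν → ℚ := Pi.single q 1

variable (k : Fin ν → ℤ)

/-- The vector `ϖ = Σ_i (k_i/p) Σ_j j·D_{i,j}`. -/
def varpi : Idx p ν → ℚ := fun q => (k q.1 : ℚ) * ((q.2.1 : ℚ) + 1) / p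

/-- The Nikulin lattice `N_p`, generated by the `D_{i,j}` together with `ϖ`. -/
def NL : AddSubgroup (Idx p ν → ℚ) :=
  AddSubgroup.closure (Set.range (Dv p ν) ∪ {varpi p ν k})

/-- The Weyl vector `ϱ = −(1/2) Σ_i Σ_j j(p−j)·D_{i,j}`. -/
def rho : Idx p ν → ℚ :=
  fun q => -(((q.2.1 : ℚ) + 1) * ((p : ℚ) - ((q.2.1 : ℚ) + 1)) / 2)

/-- The lattice `L_p = {x ∈ N_p : B(ϱ, x) ∈ pℤ}`. -/
def LL : AddSubgroup (Idx p ν → ℚ) where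
  carrier := {x | x ∈ NL p ν k ∧ ∃ m : ℤ, Bf p ν (rho p ν) x = (p : ℚ) * m}
  zero_mem' := ⟨(NL p ν k).zero_mem, 0, by simp⟩
  add_mem' := by
    rintro a b ⟨haN, ma, hma⟩ ⟨hbN, mb, hmb⟩
    exact ⟨add_mem haN hbN, ma + mb, by rw [map_add, hma, hmb]; push_cast; ring⟩
  neg_mem' := by
    rintro a ⟨haN, ma, hma⟩
    exact ⟨neg_mem haN, -ma, by rw [map_neg, hma]; push_cast; ring⟩

/-- The dual lattice `S^∨ = {y ∈ V : B(y, s) ∈ ℤ for all s ∈ S}`. -/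
def dual (S : AddSubgroup (Idx p ν → ℚ)) : AddSubgroup (Idx p ν → ℚ) where
  carrier := {y | ∀ s ∈ S, ∃ m : ℤ, Bf p ν y s = (m : ℚ)}
  zero_mem' := by
    intro s hs
    exact ⟨0, by simp⟩
  add_mem' := by
    rintro a b ha hb s hs
    obtain ⟨ma, hma⟩ := ha s hs
    obtain ⟨mb, hmb⟩ := hb s hs
    exact ⟨ma + mb, by rw [map_add, LinearMap.add_apply, hma, hmb]; push_cast; ring⟩
  neg_mem' := by
    rintro a ha s hs
    obtain ⟨m, hm⟩ := ha s hs
    exact ⟨-m, by rw [map_neg, LinearMap.neg_apply, hm]; push_cast; ring⟩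

/-- The list of admissible data `(p, ν, k)`:
`(2, 8, (1,…,1))`, `(3, 6, (1,…,1))`, `(5, 4, (1,1,2,2))`, `(7, 3, (1,2,3))`. -/
def goodCase : Prop :=
  (p = 2 ∧ ∃ h : ν = 8, ∀ i, k i = ![1, 1, 1, 1, 1, 1, 1, 1] (Fin.cast h i)) ∨
  (p = 3 ∧ ∃ h : ν = 6, ∀ i, k i = ![1, 1, 1, 1, 1, 1] (Fin.cast h i)) ∨
  (p = 5 ∧ ∃ h : ν = 4, ∀ i, k i = ![1, 1, 2, 2] (Fin.cast h i)) ∨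
  (p = 7 ∧ ∃ h : ν = 3, ∀ i, k i = ![1, 2, 3] (Fin.cast h i))

end

end Nikulin

namespace Nikulin

noncomputable section
variable (p ν : ℕ) (k : Fin ν → ℤ)

/-- The image `σ(D_{i,j}) = D_{i, (j+k_i) mod p}`, with the convention
`D_{i,0} = −Σ_{j=1}^{p−1} D_{i,j}`. -/
def Dimg (q : Idx p ν) : Idx p ν → ℚ :=
  if h : 0 < (((q.2.1 : ℤ) + 1 + k q.1) % (p : ℤ)).toNat ∧
      (((q.2.1 : ℤ) + 1 + k q.1) % (p : ℤ)).toNat < p then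
    Dv p ν (q.1, ⟨(((q.2.1 : ℤ) + 1 + k q.1) % (p : ℤ)).toNat - 1, by omega⟩)
  else -∑ j : Fin (p - 1), Dv p ν (q.1, j)

/-- The linear map `σ` determined by `σ(D_{i,j}) = D_{i, (j+k_i) mod p}`. -/
def sigmaL : (Idx p ν → ℚ) →ₗ[ℚ] (Idx p ν → ℚ) :=
  (Pi.basisFun ℚ (Idx p ν)).constr ℚ (Dimg p ν k)

end

end Nikulin

namespace Nikulin

noncomputable section

/-- The integers inside `ℚ`. -/
abbrev integers : AddSubgroup ℚ := (Int.castAddHom ℚ).range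

lemma mem_integers {r : ℚ} : r ∈ integers ↔ ∃ m : ℤ, r = m := by
  simp only [AddMonoidHom.mem_range, Int.coe_castAddHom, eq_comm]

lemma intCast_mem_integers (m : ℤ) : (m : ℚ) ∈ integers := ⟨m, rfl⟩

variable {p ν : ℕ}

lemma sigmaL_Dv (k : Fin ν → ℤ) (q : Idx p ν) : sigmaL p ν k (Dv p ν q) = Dimg p ν k q := by
  have := (Pi.basisFun ℚ (Idx p ν)).constr_basis ℚ (Dimg p ν k) q
  rwa [Pi.basisFun_apply] at this

lemma linearMap_ext_Dv {M : Type*} [AddCommGroup M] [Module ℚ M]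
    {f g : (Idx p ν → ℚ) →ₗ[ℚ] M} (h : ∀ q, f (Dv p ν q) = g (Dv p ν q)) : f = g := by
  refine (Pi.basisFun ℚ (Idx p ν)).ext fun q => ?_
  rw [Pi.basisFun_apply]
  exact h q

lemma Dv_mem_NL (k : Fin ν → ℤ) (q : Idx p ν) : Dv p ν q ∈ NL p ν k :=
  AddSubgroup.subset_closure (Or.inl ⟨q, rfl⟩)

lemma varpi_mem_NL (k : Fin ν → ℤ) : varpi p ν k ∈ NL p ν k :=
  AddSubgroup.subset_closure (Or.inr rfl)

lemma mem_NL_of_apply_mem (k : Fin ν → ℤ) {x : Idx p ν → ℚ} (h : ∀ q, x q ∈ integers) :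
    x ∈ NL p ν k := by
  simp only [mem_integers] at h
  choose m hm using h
  have hx : x = ∑ q, m q • Dv p ν q := by
    funext r
    simp [hm, Finset.sum_apply, Dv, Pi.single_apply]
  rw [hx]
  exact sum_mem fun q _ => zsmul_mem (Dv_mem_NL k q) _

lemma apply_mem_of_mem_NL {k : Fin ν → ℤ} (f : (Idx p ν → ℚ) →ₗ[ℚ] ℚ)
    (hD : ∀ q, f (Dv p ν q) ∈ integers) (hw : f (varpi p ν k) ∈ integers)
    {x : Idx p ν → ℚ} (hx : x ∈ NL p ν k) : f x ∈ integers := by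
  have : NL p ν k ≤ integers.comap f.toAddMonoidHom := by
    refine (AddSubgroup.closure_le _).2 ?_
    rintro _ (⟨q, rfl⟩ | rfl)
    · exact hD q
    · exact hw
  exact this hx

variable [Fact p.Prime]

/-- The residue class modulo `p` labelling the basis vector `D_{i,j+1}`. -/
def slot (j : Fin (p - 1)) : ZMod p := ((j.1 + 1 : ℕ) : ZMod p)

lemma slot_val (j : Fin (p - 1)) : (slot j).val = j.1 + 1 :=
  ZMod.val_cast_of_lt (by omega)

lemma slot_ne_zero (j : Fin (p - 1)) : slot j ≠ 0 := by
  intro h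
  have := slot_val j
  simp [h] at this

lemma slot_injective : Function.Injective (slot : Fin (p - 1) → ZMod p) := by
  intro a b h
  have := congrArg ZMod.val h
  rw [slot_val, slot_val] at this
  exact Fin.ext (by omega)

lemma val_pos_of_ne_zero {z : ZMod p} (hz : z ≠ 0) : 0 < z.val := by
  rw [Nat.pos_iff_ne_zero]
  simpa using hz

lemma exists_slot {z : ZMod p} (hz : z ≠ 0) : ∃ j : Fin (p - 1), slot j = z := by
  have h1 := z.val_lt
  have h2 := val_pos_of_ne_zero hz
  refine ⟨⟨z.val - 1, by omega⟩, ZMod.val_injective p ?_⟩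
  rw [slot_val]
  dsimp only
  omega

lemma val_add_one (z : ZMod p) : ((z + 1).val : ℚ) = z.val + 1 - if z = -1 then (p : ℚ) else 0 := by
  have : Fact (1 < p) := ⟨(Fact.out : p.Prime).one_lt⟩
  split_ifs with h
  · have h1 := z.val_lt
    have h2 : p ∣ z.val + 1 := by
      rw [← ZMod.natCast_eq_zero_iff]
      simp [h]
    have h3 : z.val + 1 = p := le_antisymm h1 (Nat.le_of_dvd (by omega) h2)
    have h4 : (z.val : ℚ) + 1 = p := by exact_mod_cast h3
    rw [h4]
    simp [h]
  · have h1 : z.val + 1 < p := by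
      refine lt_of_le_of_ne z.val_lt fun h2 => h ?_
      rw [eq_neg_iff_add_eq_zero]
      have := congrArg (Nat.cast : ℕ → ZMod p) h2
      simpa using this
    rw [ZMod.val_add_of_lt (by rwa [ZMod.val_one]), ZMod.val_one]
    simp

/-- The coefficient of `x` at `D_{i,z}` for `z` a residue modulo `p`, with value `0` at `z = 0`. -/
def coeff (i : Fin ν) (z : ZMod p) : (Idx p ν → ℚ) →ₗ[ℚ] ℚ :=
  if h : 0 < z.val then
    LinearMap.proj (i, (⟨z.val - 1, by have := z.val_lt; omega⟩ : Fin (p - 1)))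
  else 0

lemma coeff_zero (i : Fin ν) (x : Idx p ν → ℚ) : coeff i (0 : ZMod p) x = 0 := by
  simp [coeff]

lemma coeff_slot (i : Fin ν) (j : Fin (p - 1)) (x : Idx p ν → ℚ) :
    coeff i (slot j) x = x (i, j) := by
  simp [coeff, slot_val]

lemma coeff_Dv (i : Fin ν) (z : ZMod p) (q : Idx p ν) :
    coeff i z (Dv p ν q) = if i = q.1 ∧ z = slot q.2 then 1 else 0 := by
  by_cases hz : z = 0
  · rw [hz, coeff_zero, if_neg]
    exact fun h => slot_ne_zero q.2 h.2.symm
  · obtain ⟨j, rfl⟩ := exists_slot hz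
    rw [coeff_slot, Dv, Pi.single_apply]
    simp only [Prod.ext_iff, slot_injective.eq_iff]

lemma coeff_Dimg (k : Fin ν → ℤ) (i : Fin ν) (z : ZMod p) (q : Idx p ν) :
    coeff i z (Dimg p ν k q) = if i = q.1 then
      (if z = slot q.2 + k i then 1 else 0) - (if 0 = slot q.2 + (k i : ZMod p) then 1 else 0)
      else 0 := by
  have hp : 0 < p := (Fact.out : p.Prime).pos
  set r := (((q.2.1 : ℤ) + 1 + k q.1) % (p : ℤ)).toNat with hr
  have hrp : r < p := by
    have := Int.emod_lt_of_pos ((q.2.1 : ℤ) + 1 + k q.1) (by exact_mod_cast hp : (0 : ℤ) < p)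
    omega
  have hrz : (r : ZMod p) = slot q.2 + k q.1 := by
    have h0 := Int.emod_nonneg ((q.2.1 : ℤ) + 1 + k q.1) (by exact_mod_cast hp.ne' : (p : ℤ) ≠ 0)
    have h1 : ((r : ℤ) : ZMod p) = (((q.2.1 : ℤ) + 1 + k q.1 : ℤ) : ZMod p) := by
      rw [hr, Int.toNat_of_nonneg h0, ZMod.intCast_mod]
    simpa [slot] using h1
  by_cases hi : i = q.1
  · subst hi
    rw [if_pos rfl, ← hrz]
    by_cases h : 0 < r
    · have hne : (r : ZMod p) ≠ 0 := by
        intro h0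
        have := ZMod.val_cast_of_lt hrp
        simp [h0] at this
        omega
      have hs : slot (⟨r - 1, by omega⟩ : Fin (p - 1)) = (r : ZMod p) := by
        simp only [slot]
        congr 1
        omega
      rw [Dimg, dif_pos ⟨h, hrp⟩, coeff_Dv, if_neg hne.symm]
      simp only [← hr, hs, true_and, sub_zero]
    · have h0 : r = 0 := by omega
      rw [Dimg, dif_neg fun h' => h h'.1, map_neg, map_sum, h0]
      simp only [coeff_Dv, true_and]
      by_cases hz : z = 0
      · simp [hz, (slot_ne_zero _).symm]
      · obtain ⟨j, rfl⟩ := exists_slot hz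
        simp [slot_injective.eq_iff, slot_ne_zero]
  · rw [if_neg hi, Dimg]
    split_ifs
    · simp [coeff_Dv, hi]
    · simp [coeff_Dv, hi]

lemma coeff_sigmaL (k : Fin ν → ℤ) (i : Fin ν) (z : ZMod p) (x : Idx p ν → ℚ) :
    coeff i z (sigmaL p ν k x) = coeff i (z - (k i : ZMod p)) x - coeff i (-(k i : ZMod p)) x := by
  have : (coeff i z).comp (sigmaL p ν k) = coeff i (z - (k i : ZMod p)) - coeff i (-(k i : ZMod p)) := by
    refine linearMap_ext_Dv fun q => ?_
    rw [LinearMap.comp_apply, sigmaL_Dv, coeff_Dimg, LinearMap.sub_apply, coeff_Dv, coeff_Dv]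
    by_cases hi : i = q.1
    · simp [hi, sub_eq_iff_eq_add, neg_eq_iff_add_eq_zero, eq_comm, add_comm]
    · simp [hi]
  exact LinearMap.congr_fun this x

/-- The difference of consecutive coefficients: the coordinates of `x` in the standard embedding
of the root lattice `A_{p-1}` into `ℤ^p`. -/
def jump (i : Fin ν) (z : ZMod p) : (Idx p ν → ℚ) →ₗ[ℚ] ℚ := coeff i (z + 1) - coeff i z

lemma jump_apply (i : Fin ν) (z : ZMod p) (x : Idx p ν → ℚ) :
    jump i z x = coeff i (z + 1) x - coeff i z x := rfl

lemma jump_sigmaL (k : Fin ν → ℤ) (i : Fin ν) (z : ZMod p) (x : Idx p ν → ℚ) :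
    jump i z (sigmaL p ν k x) = jump i (z - (k i : ZMod p)) x := by
  simp only [jump_apply, coeff_sigmaL]
  rw [show z + 1 - (k i : ZMod p) = z - k i + 1 by ring]
  ring

lemma jump_Dv (i : Fin ν) (z : ZMod p) (q : Idx p ν) :
    jump i z (Dv p ν q) =
      if i = q.1 then (if z = slot q.2 - 1 then 1 else 0) - (if z = slot q.2 then 1 else 0)
      else 0 := by
  rw [jump_apply, coeff_Dv, coeff_Dv]
  by_cases hi : i = q.1 <;> simp [hi, eq_sub_iff_add_eq]

lemma sum_jump (i : Fin ν) (x : Idx p ν → ℚ) : ∑ z : ZMod p, jump i z x = 0 := by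
  simp only [jump_apply, Finset.sum_sub_distrib]
  rw [sub_eq_zero]
  exact Equiv.sum_comp (Equiv.addRight (1 : ZMod p)) fun z => coeff i z x

lemma coeff_mem_of_jump_mem {i : Fin ν} {x : Idx p ν → ℚ} (h : ∀ z : ZMod p, jump i z x ∈ integers)
    (z : ZMod p) : coeff i z x ∈ integers := by
  obtain ⟨n, rfl⟩ := ZMod.natCast_zmod_surjective z
  induction n with
  | zero => simp [coeff_zero]
  | succ n ih =>
    have := integers.add_mem (h n) ih
    rwa [jump_apply, sub_add_cancel, ← Nat.cast_succ] at this

lemma apply_mem_of_jump_mem {x : Idx p ν → ℚ}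
    (h : ∀ i, ∀ z : ZMod p, jump i z x ∈ integers) (q : Idx p ν) : x q ∈ integers := by
  have := coeff_mem_of_jump_mem (h q.1) (slot q.2)
  rwa [coeff_slot] at this

lemma ext_jump {x y : Idx p ν → ℚ} (h : ∀ i, ∀ z : ZMod p, jump i z x = jump i z y) : x = y := by
  have key (i : Fin ν) (n : ℕ) : coeff i (n : ZMod p) x = coeff i (n : ZMod p) y := by
    induction n with
    | zero => simp [coeff_zero]
    | succ n ih =>
      have := h i n
      rw [jump_apply, jump_apply, ih] at this
      push_cast
      linarith
  funext q
  have := key q.1 (q.2.1 + 1)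
  rwa [← slot, coeff_slot, coeff_slot] at this

lemma slot_eq_slot_sub_one_iff (a b : Fin (p - 1)) : slot a = slot b - 1 ↔ a.1 + 1 = b.1 := by
  rw [eq_sub_iff_add_eq]
  constructor
  · intro h
    have h1 : ((a.1 : ℕ) + 1 : ZMod p) = (b.1 : ℕ) := by
      simpa [slot] using h
    have h2 := congrArg ZMod.val h1
    rw [ZMod.val_cast_of_lt (by omega), ← Nat.cast_add_one, ZMod.val_cast_of_lt (by omega)] at h2
    exact h2
  · intro h
    simp [slot, ← h]

theorem Bf_eq_sum_jump (x y : Idx p ν → ℚ) :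
    Bf p ν x y = -∑ i, ∑ z : ZMod p, jump i z x * jump i z y := by
  let C : (Idx p ν → ℚ) →ₗ[ℚ] (Idx p ν → ℚ) →ₗ[ℚ] ℚ :=
    -∑ i : Fin ν, ∑ z : ZMod p, (LinearMap.mul ℚ ℚ).compl₁₂ (jump i z) (jump i z)
  have hC (x y) : C x y = -∑ i, ∑ z : ZMod p, jump i z x * jump i z y := by
    simp [C, LinearMap.sum_apply]
  suffices Bf p ν = C by rw [this, hC]
  refine linearMap_ext_Dv fun a => linearMap_ext_Dv fun b => ?_
  have hB : Bf p ν (Dv p ν a) (Dv p ν b) = gram p ν a b := by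
    simp [Bf, Dv, Pi.single_apply]
  rw [hB, hC]
  simp only [jump_Dv]
  rw [Finset.sum_eq_single a.1 (by intro i _ hi; simp [hi]) (by simp)]
  by_cases hab : a.1 = b.1
  · simp only [hab, if_true, mul_sub, mul_ite, mul_zero, mul_one,
      Finset.sum_sub_distrib, Finset.sum_ite_eq', Finset.mem_univ,
      sub_left_inj, slot_injective.eq_iff, slot_eq_slot_sub_one_iff, gram]
    simp only [eq_comm (a := slot b.2 - 1), slot_eq_slot_sub_one_iff]
    by_cases h : a.2 = b.2
    · simp [h]; norm_num
    · have h' : a.2.1 ≠ b.2.1 := fun h' => h (Fin.ext h')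
      simp only [h, if_false]
      split_ifs <;> first | omega | norm_num
  · simp [gram, hab]

lemma Bf_comm (x y : Idx p ν → ℚ) : Bf p ν x y = Bf p ν y x := by
  simp only [Bf_eq_sum_jump, mul_comm]

theorem Bf_sigmaL (k : Fin ν → ℤ) (x y : Idx p ν → ℚ) :
    Bf p ν (sigmaL p ν k x) (sigmaL p ν k y) = Bf p ν x y := by
  simp only [Bf_eq_sum_jump, jump_sigmaL]
  congr 1
  refine Finset.sum_congr rfl fun i _ => ?_
  exact Equiv.sum_comp (Equiv.subRight (k i : ZMod p)) fun z => jump i z x * jump i z y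

lemma Bf_Dv (x : Idx p ν → ℚ) (q : Idx p ν) :
    Bf p ν x (Dv p ν q) = jump q.1 (slot q.2) x - jump q.1 (slot q.2 - 1) x := by
  rw [Bf_eq_sum_jump]
  simp only [jump_Dv]
  rw [Finset.sum_eq_single q.1 (by intro i _ hi; simp [hi]) (by simp)]
  simp [mul_sub]

lemma jump_sigmaL_pow (k : Fin ν → ℤ) (i : Fin ν) (n : ℕ) (z : ZMod p) (x : Idx p ν → ℚ) :
    jump i z ((sigmaL p ν k ^ n) x) = jump i (z - (n : ZMod p) * (k i : ZMod p)) x := by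
  induction n generalizing z with
  | zero => simp
  | succ n ih =>
    rw [pow_succ', Module.End.mul_apply, jump_sigmaL, ih]
    congr 2
    push_cast
    ring

lemma sigmaL_pow_prime (k : Fin ν → ℤ) : sigmaL p ν k ^ p = 1 := by
  refine LinearMap.ext fun x => ext_jump fun i z => ?_
  rw [jump_sigmaL_pow]
  simp

lemma sigmaL_ne_one {k : Fin ν → ℤ} {i : Fin ν} (hi : (k i : ZMod p) ≠ 0) : sigmaL p ν k ≠ 1 := by
  intro h
  obtain ⟨j, hj⟩ := exists_slot (one_ne_zero : (1 : ZMod p) ≠ 0)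
  have h1 := coeff_sigmaL k i (1 : ZMod p) (Dv p ν (i, j))
  simp only [h, Module.End.one_apply, coeff_Dv, hj, true_and, if_true, sub_eq_self, hi,
    if_false] at h1
  split_ifs at h1 <;> norm_num at h1

theorem orderOf_sigmaL {k : Fin ν → ℤ} {i : Fin ν} (hi : (k i : ZMod p) ≠ 0) :
    orderOf (sigmaL p ν k) = p :=
  orderOf_eq_prime (sigmaL_pow_prime k) (sigmaL_ne_one hi)

lemma mem_iff_sigmaL_mem {k : Fin ν → ℤ} {S : AddSubgroup (Idx p ν → ℚ)}
    (hS : ∀ x ∈ S, sigmaL p ν k x ∈ S) (x : Idx p ν → ℚ) : x ∈ S ↔ sigmaL p ν k x ∈ S := by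
  refine ⟨hS x, fun hx => ?_⟩
  have hpow (n : ℕ) : (sigmaL p ν k ^ n) (sigmaL p ν k x) ∈ S := by
    induction n with
    | zero => simpa using hx
    | succ n ih =>
      rw [pow_succ', Module.End.mul_apply]
      exact hS _ ih
  have := hpow (p - 1)
  rwa [← Module.End.mul_apply, pow_sub_one_mul (Fact.out : p.Prime).ne_zero,
    sigmaL_pow_prime, Module.End.one_apply] at this

/-- The rotation acts trivially on the discriminant group of `A_{p-1}^ν`. -/
lemma sigmaL_sub_self_mem_NL (k : Fin ν → ℤ) {y : Idx p ν → ℚ}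
    (hy : ∀ q, Bf p ν y (Dv p ν q) ∈ integers) : sigmaL p ν k y - y ∈ NL p ν k := by
  have key (i : Fin ν) (n : ℕ) (hn : n < p) :
      jump i (n : ZMod p) y - jump i 0 y ∈ integers := by
    induction n with
    | zero => simp
    | succ n ih =>
      have h1 := hy (i, ⟨n, by omega⟩)
      have h2 := integers.add_mem h1 (ih (by omega))
      simpa [Bf_Dv, slot] using h2
  refine mem_NL_of_apply_mem k (apply_mem_of_jump_mem fun i z => ?_)
  have h1 := key i z.val z.val_lt
  have h2 := key i (z - k i).val (z - k i).val_lt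
  rw [ZMod.natCast_zmod_val] at h1 h2
  rw [map_sub, jump_sigmaL]
  simpa using integers.sub_mem h2 h1

lemma jump_varpi (k : Fin ν → ℤ) (i : Fin ν) (z : ZMod p) :
    jump i z (varpi p ν k) = k i / p - if z = -1 then (k i : ℚ) else 0 := by
  have hp : (p : ℚ) ≠ 0 := by exact_mod_cast (Fact.out : p.Prime).ne_zero
  have key (z : ZMod p) : coeff i z (varpi p ν k) = k i * z.val / p := by
    by_cases hz : z = 0
    · simp [hz, coeff_zero]
    · obtain ⟨j, rfl⟩ := exists_slot hz
      rw [coeff_slot, slot_val]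
      simp [varpi]
  rw [jump_apply, key, key, val_add_one]
  split_ifs <;> field_simp <;> ring

lemma jump_rho (i : Fin ν) (z : ZMod p) :
    jump i z (rho p ν) = z.val - ((p : ℚ) - 1) / 2 := by
  have key (z : ZMod p) : coeff i z (rho p ν) = -(z.val * (p - z.val) / 2) := by
    by_cases hz : z = 0
    · simp [hz, coeff_zero]
    · obtain ⟨j, rfl⟩ := exists_slot hz
      rw [coeff_slot, slot_val]
      simp [rho]
  have h := val_add_one z
  rw [jump_apply, key, key]
  split_ifs at h with hz
  · have h0 : ((z + 1).val : ℚ) = 0 := by simp [hz]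
    rw [h0] at h ⊢
    have hv : (z.val : ℚ) = p - 1 := by linarith
    rw [hv]
    ring
  · rw [h]
    ring

lemma Bf_rho_Dv (q : Idx p ν) : Bf p ν (rho p ν) (Dv p ν q) = 1 := by
  have h := val_add_one (slot q.2 - 1)
  rw [if_neg (by simpa using slot_ne_zero q.2), sub_add_cancel] at h
  rw [Bf_Dv, jump_rho, jump_rho, h]
  ring

lemma Bf_varpi_Dv_mem (k : Fin ν → ℤ) (q : Idx p ν) :
    Bf p ν (varpi p ν k) (Dv p ν q) ∈ integers := by
  have h : slot q.2 - 1 ≠ -1 := by simpa [sub_eq_neg_self] using slot_ne_zero q.2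
  rw [Bf_Dv, jump_varpi, jump_varpi, if_neg h, mem_integers]
  refine ⟨-if slot q.2 = -1 then k q.1 else 0, ?_⟩
  push_cast
  ring

lemma Bf_varpi_varpi (k : Fin ν → ℤ) :
    Bf p ν (varpi p ν k) (varpi p ν k) = -(((p : ℚ) - 1) * ∑ i, (k i : ℚ) ^ 2) / p := by
  have hp : (p : ℚ) ≠ 0 := by exact_mod_cast (Fact.out : p.Prime).ne_zero
  rw [Bf_eq_sum_jump, neg_div, Finset.mul_sum, Finset.sum_div]
  congr 1
  refine Finset.sum_congr rfl fun i _ => ?_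
  have h : ∑ z : ZMod p, jump i z (varpi p ν k) * jump i z (varpi p ν k) =
      ∑ z : ZMod p, jump i z (varpi p ν k) * (k i / p) -
        ∑ z : ZMod p, jump i z (varpi p ν k) * if z = -1 then (k i : ℚ) else 0 := by
    rw [← Finset.sum_sub_distrib]
    refine Finset.sum_congr rfl fun z _ => ?_
    rw [← mul_sub, ← jump_varpi]
  rw [h, ← Finset.sum_mul, sum_jump]
  simp only [mul_ite, mul_zero, Finset.sum_ite_eq', Finset.mem_univ, if_true, jump_varpi]
  field_simp
  ring

lemma Bf_rho_varpi (k : Fin ν → ℤ) :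
    Bf p ν (rho p ν) (varpi p ν k) = ((p : ℚ) - 1) * (∑ i, (k i : ℚ)) / 2 := by
  rw [Bf_eq_sum_jump, Finset.mul_sum, Finset.sum_div, ← Finset.sum_neg_distrib]
  refine Finset.sum_congr rfl fun i _ => ?_
  simp only [jump_varpi, mul_sub, mul_ite, mul_zero, Finset.sum_sub_distrib, ← Finset.sum_mul,
    sum_jump, Finset.sum_ite_eq', Finset.mem_univ, if_true]
  rw [jump_rho]
  have h := val_add_one (-1 : ZMod p)
  simp only [neg_add_cancel, ZMod.val_zero, if_true, Nat.cast_zero] at h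
  have hv : ((-1 : ZMod p).val : ℚ) = p - 1 := by linarith
  rw [hv]
  ring

/-- The arithmetic of `(p, ν, k)` on which the properties of the lattices `N_p`, `L_p` depend. -/
structure Numerics (p ν : ℕ) [Fact p.Prime] (k : Fin ν → ℤ) : Prop where
  exists_ne_zero : ∃ i, (k i : ZMod p) ≠ 0
  dvd_sum_sq : (p : ℤ) ∣ (p - 1) * ∑ i, k i ^ 2
  even_sum : (2 : ℤ) ∣ (p - 1) * ∑ i, k i
  sq_dvd_sum : (p : ℤ) ^ 2 ∣ ∑ i, ∑ z : ZMod p, (z.val : ℤ) * ((z - (k i : ZMod p)).val - z.val)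

section

variable {k : Fin ν → ℤ}

lemma Bf_Dv_mem {x : Idx p ν → ℚ} (hx : x ∈ NL p ν k) (q : Idx p ν) :
    Bf p ν x (Dv p ν q) ∈ integers := by
  rw [Bf_comm]
  refine apply_mem_of_mem_NL _ (fun r => ?_) ?_ hx
  · rw [mem_integers, Bf_eq_sum_jump]
    refine ⟨-∑ i, ∑ z : ZMod p,
      (if i = q.1 then (if z = slot q.2 - 1 then 1 else 0) - (if z = slot q.2 then 1 else 0)
        else 0) *
      (if i = r.1 then (if z = slot r.2 - 1 then 1 else 0) - (if z = slot r.2 then 1 else 0)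
        else 0), ?_⟩
    push_cast
    simp only [jump_Dv]
  · rw [Bf_comm]
    exact Bf_varpi_Dv_mem k q

lemma Bf_mem (hk : Numerics p ν k) {x y : Idx p ν → ℚ} (hx : x ∈ NL p ν k) (hy : y ∈ NL p ν k) :
    Bf p ν x y ∈ integers := by
  refine apply_mem_of_mem_NL _ (Bf_Dv_mem hx) ?_ hy
  rw [Bf_comm]
  refine apply_mem_of_mem_NL _ (Bf_varpi_Dv_mem k) ?_ hx
  have hp : (p : ℚ) ≠ 0 := by exact_mod_cast (Fact.out : p.Prime).ne_zero
  obtain ⟨m, hm⟩ := hk.dvd_sum_sq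
  have hm' : ((p : ℚ) - 1) * ∑ i, (k i : ℚ) ^ 2 = p * m := by exact_mod_cast hm
  rw [Bf_varpi_varpi, hm', mem_integers]
  refine ⟨-m, ?_⟩
  push_cast
  field_simp

lemma Bf_rho_mem (hk : Numerics p ν k) {x : Idx p ν → ℚ} (hx : x ∈ NL p ν k) :
    Bf p ν (rho p ν) x ∈ integers := by
  refine apply_mem_of_mem_NL _ (fun q => ?_) ?_ hx
  · rw [Bf_rho_Dv]
    exact intCast_mem_integers 1
  · obtain ⟨m, hm⟩ := hk.even_sum
    have hm' : ((p : ℚ) - 1) * ∑ i, (k i : ℚ) = 2 * m := by exact_mod_cast hm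
    rw [Bf_rho_varpi, hm', mem_integers]
    exact ⟨m, by ring⟩

lemma sigmaL_mem_NL {x : Idx p ν → ℚ} (hx : x ∈ NL p ν k) :
    sigmaL p ν k x ∈ NL p ν k := by
  have := add_mem (sigmaL_sub_self_mem_NL k (Bf_Dv_mem hx)) hx
  rwa [sub_add_cancel] at this

variable (p ν k) in
/-- The vector `(σ(ϱ) − ϱ) / p`. -/
def rhoShift : Idx p ν → ℚ := (p : ℚ)⁻¹ • (sigmaL p ν k (rho p ν) - rho p ν)

lemma smul_rhoShift : (p : ℚ) • rhoShift p ν k = sigmaL p ν k (rho p ν) - rho p ν := by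
  have hp : (p : ℚ) ≠ 0 := by exact_mod_cast (Fact.out : p.Prime).ne_zero
  rw [rhoShift, smul_inv_smul₀ hp]

lemma jump_rhoShift (i : Fin ν) (z : ZMod p) :
    jump i z (rhoShift p ν k) = (p : ℚ)⁻¹ * ((z - (k i : ZMod p)).val - z.val) := by
  rw [rhoShift, map_smul, map_sub, jump_sigmaL, jump_rho, jump_rho, smul_eq_mul]
  ring

lemma rhoShift_mem_NL : rhoShift p ν k ∈ NL p ν k := by
  have hp : (p : ℚ) ≠ 0 := by exact_mod_cast (Fact.out : p.Prime).ne_zero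
  suffices h : rhoShift p ν k + varpi p ν k ∈ NL p ν k by
    have := sub_mem h (varpi_mem_NL k)
    rwa [add_sub_cancel_right] at this
  refine mem_NL_of_apply_mem k (apply_mem_of_jump_mem fun i z => ?_)
  have hdvd : (p : ℤ) ∣ ((z - k i).val : ℤ) - z.val + k i := by
    rw [← ZMod.intCast_zmod_eq_zero_iff_dvd]
    simp
  obtain ⟨m, hm⟩ := hdvd
  have hm' : ((z - k i).val : ℚ) - z.val + k i = p * m := by exact_mod_cast hm
  rw [map_add, jump_rhoShift, jump_varpi, mem_integers]
  refine ⟨m - if z = -1 then k i else 0, ?_⟩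
  push_cast
  have hm'' : (m : ℚ) = (((z - (k i : ZMod p)).val : ℚ) - z.val + k i) / p := by
    rw [hm']
    field_simp
  rw [hm'']
  ring

lemma Bf_rho_sigmaL (x : Idx p ν → ℚ) :
    Bf p ν (rho p ν) (sigmaL p ν k x) =
      Bf p ν (rho p ν) x - p * Bf p ν (rhoShift p ν k) (sigmaL p ν k x) := by
  have h : (p : ℚ) * Bf p ν (rhoShift p ν k) (sigmaL p ν k x) =
      Bf p ν (sigmaL p ν k (rho p ν)) (sigmaL p ν k x) - Bf p ν (rho p ν) (sigmaL p ν k x) := by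
    rw [← LinearMap.sub_apply, ← map_sub, ← smul_rhoShift, map_smul, LinearMap.smul_apply,
      smul_eq_mul]
  rw [h, Bf_sigmaL]
  ring

lemma sigmaL_mem_LL {x : Idx p ν → ℚ} (hk : Numerics p ν k) (hx : x ∈ LL p ν k) :
    sigmaL p ν k x ∈ LL p ν k := by
  obtain ⟨hxN, m, hm⟩ := hx
  have hσ := sigmaL_mem_NL hxN
  obtain ⟨n, hn⟩ := mem_integers.1 (Bf_mem hk rhoShift_mem_NL hσ)
  refine ⟨hσ, m - n, ?_⟩
  rw [Bf_rho_sigmaL, hm, hn]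
  push_cast
  ring

lemma rhoShift_mem_LL (hk : Numerics p ν k) : rhoShift p ν k ∈ LL p ν k := by
  have hp : (p : ℚ) ≠ 0 := by exact_mod_cast (Fact.out : p.Prime).ne_zero
  obtain ⟨m, hm⟩ := hk.sq_dvd_sum
  have hm' : ∑ i, ∑ z : ZMod p, (z.val : ℚ) * ((z - (k i : ZMod p)).val - z.val) = (p : ℚ) ^ 2 * m := by
    exact_mod_cast hm
  refine ⟨rhoShift_mem_NL, -m, ?_⟩
  have h : ∑ i, ∑ z : ZMod p, jump i z (rho p ν) * jump i z (rhoShift p ν k) =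
      (p : ℚ)⁻¹ * ∑ i, ∑ z : ZMod p, (z.val : ℚ) * ((z - (k i : ZMod p)).val - z.val) := by
    rw [Finset.mul_sum]
    refine Finset.sum_congr rfl fun i _ => ?_
    simp only [jump_rho, sub_mul, Finset.sum_sub_distrib, ← Finset.mul_sum, sum_jump]
    rw [mul_zero, sub_zero, Finset.mul_sum]
    refine Finset.sum_congr rfl fun z _ => ?_
    rw [jump_rhoShift]
    ring
  rw [Bf_eq_sum_jump, h, hm']
  push_cast
  field_simp

lemma sigmaL_sub_self_mem_LL_of_mem_dual_NL (hk : Numerics p ν k) {y : Idx p ν → ℚ}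
    (hy : y ∈ dual p ν (NL p ν k)) : sigmaL p ν k y - y ∈ LL p ν k := by
  have hN : sigmaL p ν k y - y ∈ NL p ν k :=
    sigmaL_sub_self_mem_NL k fun q => mem_integers.2 (hy _ (Dv_mem_NL k q))
  have h1 : Bf p ν (rhoShift p ν k) (sigmaL p ν k y) ∈ integers := by
    have := integers.add_mem (Bf_mem hk rhoShift_mem_NL hN)
      (mem_integers.2 (hy _ rhoShift_mem_NL))
    rwa [Bf_comm y, ← map_add, sub_add_cancel] at this
  obtain ⟨m, hm⟩ := mem_integers.1 h1
  refine ⟨hN, -m, ?_⟩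
  rw [map_sub, Bf_rho_sigmaL, hm]
  push_cast
  ring

/-- The dual of `L` is generated by the dual of `N` and `ϱ / p`. -/
lemma exists_sub_smul_rho_mem_dual_NL (hk : Numerics p ν k) (q : Idx p ν) {y : Idx p ν → ℚ}
    (hy : y ∈ dual p ν (LL p ν k)) :
    ∃ m : ℤ, y - ((m : ℚ) / p) • rho p ν ∈ dual p ν (NL p ν k) := by
  have hp : (p : ℚ) ≠ 0 := by exact_mod_cast (Fact.out : p.Prime).ne_zero
  have hpD : p • Dv p ν q ∈ LL p ν k :=
    ⟨nsmul_mem (Dv_mem_NL k q) p, 1, by rw [map_nsmul, Bf_rho_Dv]; simp⟩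
  obtain ⟨m, hm⟩ := hy _ hpD
  rw [map_nsmul, nsmul_eq_mul] at hm
  refine ⟨m, fun n hn => ?_⟩
  obtain ⟨b, hb⟩ := mem_integers.1 (Bf_rho_mem hk hn)
  have hL : n - b • Dv p ν q ∈ LL p ν k := by
    refine ⟨sub_mem hn (zsmul_mem (Dv_mem_NL k q) b), 0, ?_⟩
    rw [map_sub, map_zsmul, Bf_rho_Dv, hb]
    simp
  obtain ⟨c, hc⟩ := hy _ hL
  refine ⟨c, ?_⟩
  rw [← hc, map_sub, LinearMap.sub_apply, map_smul, LinearMap.smul_apply, hb, map_sub, map_zsmul,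
    ← hm]
  simp only [smul_eq_mul, zsmul_eq_mul]
  field_simp

theorem sigmaL_sub_self_mem_LL (hk : Numerics p ν k) {y : Idx p ν → ℚ}
    (hy : y ∈ dual p ν (LL p ν k)) : sigmaL p ν k y - y ∈ LL p ν k := by
  obtain ⟨i, -⟩ := hk.exists_ne_zero
  obtain ⟨j, -⟩ := exists_slot (one_ne_zero : (1 : ZMod p) ≠ 0)
  obtain ⟨m, hm⟩ := exists_sub_smul_rho_mem_dual_NL hk (i, j) hy
  have h := add_mem (sigmaL_sub_self_mem_LL_of_mem_dual_NL hk hm)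
    (zsmul_mem (rhoShift_mem_LL hk) m)
  convert h using 1
  rw [rhoShift, ← Int.cast_smul_eq_zsmul ℚ, map_sub, map_smul, smul_smul, ← div_eq_mul_inv,
    smul_sub]
  abel

end

instance fact_prime_five : Fact (Nat.Prime 5) := ⟨by norm_num⟩

instance fact_prime_seven : Fact (Nat.Prime 7) := ⟨by norm_num⟩

lemma exists_numerics {p ν : ℕ} {k : Fin ν → ℤ} (hk : goodCase p ν k) :
    ∃ _ : Fact p.Prime, Numerics p ν k := by
  rcases hk with ⟨rfl, rfl, h⟩ | ⟨rfl, rfl, h⟩ | ⟨rfl, rfl, h⟩ | ⟨rfl, rfl, h⟩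
  all_goals
    obtain rfl := funext h
    exact ⟨inferInstance, ⟨0, by decide⟩, by decide, by decide, by decide⟩

end

end Nikulin

open Nikulin

/-- `σ` is a `B`-isometry of `V` of order exactly `p`, maps `N` onto `N` and `L` onto `L`, and acts trivially on the discriminant group `L^∨/L`. -/
theorem sigma_isometry_order_p_trivial_discriminant (p ν : ℕ) (k : Fin ν → ℤ) (hk : goodCase p ν k) :
    (∀ x y, Bf p ν (sigmaL p ν k x) (sigmaL p ν k y) = Bf p ν x y) ∧
    orderOf (sigmaL p ν k) = p ∧
    (∀ x, x ∈ NL p ν k ↔ sigmaL p ν k x ∈ NL p ν k) ∧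
    (∀ x, x ∈ LL p ν k ↔ sigmaL p ν k x ∈ LL p ν k) ∧
    (∀ y ∈ dual p ν (LL p ν k), sigmaL p ν k y - y ∈ LL p ν k) := by
  obtain ⟨_, hn⟩ := exists_numerics hk
  obtain ⟨i, hi⟩ := hn.exists_ne_zero
  exact ⟨Bf_sigmaL k, orderOf_sigmaL hi, mem_iff_sigmaL_mem fun _ => sigmaL_mem_NL,
    mem_iff_sigmaL_mem fun _ => sigmaL_mem_LL hn, fun _ => sigmaL_sub_self_mem_LL hn⟩
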